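/- arXiv:1111.6120 — 3 statements merged into one kernel-verified Lean document; each statement's English description precedes it below -/
import Mathlib

section
/- Let f be a nonzero invariant homogeneous polynomial of degree d in the polynomial ring ℂ[x_{ijk}] with variables indexed by (i,j,k) ∈ {1,2,3,4} × {1,2,3,4} × {1,2}. Then d is divisible by 4. -/
open MvPolynomial

/-- The derivation `D_{A,B,C}` of `ℂ[x_{ijk}]` (format `4 × 4 × 2`) determined on variables by
`D(x_{ijk}) = Σ_{i'} A_{i'i} x_{i'jk} + Σ_{j'} B_{j'j} x_{ij'k} + Σ_{k'} C_{k'k} x_{ijk'}`. -/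
noncomputable def liederiv (A : Matrix (Fin 4) (Fin 4) ℂ) (B : Matrix (Fin 4) (Fin 4) ℂ)
    (C : Matrix (Fin 2) (Fin 2) ℂ) :
    Derivation ℂ (MvPolynomial (Fin 4 × Fin 4 × Fin 2) ℂ)
      (MvPolynomial (Fin 4 × Fin 4 × Fin 2) ℂ) :=
  mkDerivation ℂ fun v =>
    (∑ i' : Fin 4, A i' v.1 • X (i', v.2.1, v.2.2)) +
    (∑ j' : Fin 4, B j' v.2.1 • X (v.1, j', v.2.2)) +
    (∑ k' : Fin 2, C k' v.2.2 • X (v.1, v.2.1, k'))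

/-- A polynomial is invariant if it is annihilated by every derivation `D_{A,B,C}` with
`A`, `B`, `C` traceless. -/
def InvariantPoly (f : MvPolynomial (Fin 4 × Fin 4 × Fin 2) ℂ) : Prop :=
  ∀ (A : Matrix (Fin 4) (Fin 4) ℂ) (B : Matrix (Fin 4) (Fin 4) ℂ)
    (C : Matrix (Fin 2) (Fin 2) ℂ), A.trace = 0 → B.trace = 0 → C.trace = 0 →
      liederiv A B C f = 0

/-- The derivation scaling each variable `x_v` by `w v` scales the monomial `x ^ m` by
`Σ_v m_v w_v`. -/
theorem coeff_mkDerivation_smul_X {σ R : Type*} [Fintype σ] [CommRing R] (w : σ → R)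
    (f : MvPolynomial σ R) (m : σ →₀ ℕ) :
    coeff m (mkDerivation R (fun v => w v • (X v : MvPolynomial σ R)) f) =
      (∑ v, (m v : R) * w v) * coeff m f := by
  classical
  induction f using MvPolynomial.induction_on' with
  | add p q hp hq => simp only [map_add, coeff_add, hp, hq, mul_add]
  | monomial s r =>
    have key : mkDerivation R (fun v => w v • (X v : MvPolynomial σ R)) (monomial s r) =
        monomial s ((∑ v, (s v : R) * w v) * r) := by
      rw [mkDerivation_monomial, Finsupp.sum_fintype _ _ (by simp), Finset.sum_mul, map_sum,
        Finset.smul_sum]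
      refine Finset.sum_congr rfl fun v _ => ?_
      rcases Nat.eq_zero_or_pos (s v) with h | h
      · simp [h]
      · rw [X, smul_monomial, smul_eq_mul, monomial_mul, smul_monomial,
          tsub_add_cancel_of_le (Finsupp.single_le_iff.2 h)]
        congr 1
        simp only [smul_eq_mul]
        ring
    rw [key, coeff_monomial, coeff_monomial]
    split_ifs with h
    · rw [h]
    · rw [mul_zero]

theorem liederiv_diagonal (a : Fin 4 → ℂ) :
    liederiv (Matrix.diagonal a) 0 0 = mkDerivation ℂ fun v => a v.1 • X v := by
  refine MvPolynomial.derivation_ext fun v => ?_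
  simp [liederiv, Matrix.diagonal_apply, ite_smul]

theorem InvariantPoly.sum_mul_eq_zero {f : MvPolynomial (Fin 4 × Fin 4 × Fin 2) ℂ}
    (hinv : InvariantPoly f) {m : Fin 4 × Fin 4 × Fin 2 →₀ ℕ} (hm : coeff m f ≠ 0)
    (a : Fin 4 → ℂ) (ha : ∑ i, a i = 0) :
    ∑ i, ((∑ p, m (i, p) : ℕ) : ℂ) * a i = 0 := by
  have h := hinv (Matrix.diagonal a) 0 0 (by rw [Matrix.trace_diagonal, ha]) (by simp) (by simp)
  rw [liederiv_diagonal] at h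
  have hc := coeff_mkDerivation_smul_X (fun v => a v.1) f m
  rw [h, coeff_zero, eq_comm, mul_eq_zero, or_iff_left hm, Fintype.sum_prod_type] at hc
  rw [← hc]
  push_cast
  simp only [Finset.sum_mul]

/-- Every monomial of an invariant polynomial involves each first index equally often. -/
theorem InvariantPoly.slice_degree_eq {f : MvPolynomial (Fin 4 × Fin 4 × Fin 2) ℂ}
    (hinv : InvariantPoly f) {m : Fin 4 × Fin 4 × Fin 2 →₀ ℕ} (hm : coeff m f ≠ 0)
    (i j : Fin 4) : ∑ p, m (i, p) = ∑ p, m (j, p) := by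
  have h := hinv.sum_mul_eq_zero hm (Pi.single i 1 - Pi.single j 1) (by simp)
  simp only [Pi.sub_apply, mul_sub, Finset.sum_sub_distrib, Pi.single_apply, mul_ite, mul_one,
    mul_zero, Finset.sum_ite_eq', Finset.mem_univ, if_true, sub_eq_zero] at h
  exact_mod_cast h

/-- Theorem 16 (first part): every nonzero invariant homogeneous polynomial for a
`4 × 4 × 2` array has degree divisible by 4. -/
theorem invariant_degree_dvd_four (d : ℕ) (f : MvPolynomial (Fin 4 × Fin 4 × Fin 2) ℂ)
    (hf : f ≠ 0) (hhom : f.IsHomogeneous d) (hinv : InvariantPoly f) :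
    4 ∣ d := by
  obtain ⟨m, hm⟩ := ne_zero_iff.1 hf
  refine ⟨∑ p, m (0, p), ?_⟩
  have hdeg : m.degree = d := not_not.1 fun h => hm (hhom.coeff_eq_zero h)
  rw [← hdeg, Finsupp.degree_eq_sum, Fintype.sum_prod_type,
    Finset.sum_congr rfl fun i _ => hinv.slice_degree_eq hm i 0]
  simp
end

section
/- Let f be a homogeneous polynomial of degree 4 in the polynomial ring ℂ[x_{ijk}] with variables indexed by (i,j,k) ∈ {1,2,3,4} × {1,2,3,4} × {1,2}. If f is invariant, i.e., D_{A,B,C} f = 0 for all traceless complex matrices A of size 4×4, B of size 4×4, C of size 2×2, then f = 0. -/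
open MvPolynomial

section SlInvariant

variable {ι κ M : Type*} [Fintype ι] [DecidableEq ι] [Fintype κ] [DecidableEq κ]
  [AddCommGroup M] [Module ℂ M]

/-- A tensor, given by its components `Q i` for multi-indices `i : ι → κ`, is `sl`-invariant if
every traceless matrix, acting on each of the indices in turn, annihilates it. -/
def SlInvariant (Q : (ι → κ) → M) : Prop :=
  ∀ A : Matrix κ κ ℂ, A.trace = 0 → ∀ i : ι → κ,
    ∑ p, ∑ a, A (i p) a • Q (Function.update i p a) = 0

namespace SlInvariant

/-- The relation given by the elementary matrix at `(a, b)`, `a ≠ b`. -/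
lemma sum_ite_update {Q : (ι → κ) → M} (hQ : SlInvariant Q) {a b : κ} (hab : a ≠ b)
    (i : ι → κ) : ∑ p, (if i p = a then Q (Function.update i p b) else 0) = 0 := by
  refine (Finset.sum_congr rfl fun p _ => ?_).trans
    (hQ (Matrix.single a b 1) (Matrix.trace_single_eq_of_ne a b 1 hab) i)
  simp [Matrix.single_apply, ite_and, eq_comm (a := a)]

/-- The relation given by the difference of the diagonal units at `a` and `b`. -/
lemma card_smul_eq {Q : (ι → κ) → M} (hQ : SlInvariant Q) (a b : κ) (i : ι → κ) :
    (Finset.univ.filter fun p => i p = a).card • Q i =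
      (Finset.univ.filter fun p => i p = b).card • Q i := by
  have h := hQ (Matrix.diagonal (Pi.single a 1 - Pi.single b 1))
    (by simp [Matrix.trace_diagonal]) i
  have hterm : ∀ p, ∑ c, Matrix.diagonal (Pi.single a 1 - Pi.single b 1 : κ → ℂ) (i p) c •
      Q (Function.update i p c) = (if i p = a then Q i else 0) - if i p = b then Q i else 0 := by
    intro p
    rw [Finset.sum_eq_single (i p) (fun c _ hc => by simp [Matrix.diagonal_apply_ne' _ hc])
      (by simp)]
    simp [sub_smul, Pi.single_apply]
  simp_rw [hterm, Finset.sum_sub_distrib, ← Finset.sum_filter, Finset.sum_const] at h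
  exact sub_eq_zero.mp h

lemma eq_zero_of_notMem_range {Q : (ι → κ) → M} (hQ : SlInvariant Q) [Nonempty ι]
    {i : ι → κ} {b : κ} (hb : b ∉ Set.range i) : Q i = 0 := by
  obtain ⟨p⟩ := ‹Nonempty ι›
  have := IsAddTorsionFree.of_isTorsionFree ℂ M
  have h := hQ.card_smul_eq (i p) b i
  rw [Finset.card_eq_zero.mpr (Finset.filter_eq_empty_iff.mpr fun q _ hq => hb ⟨q, hq⟩),
    zero_smul] at h
  refine (smul_eq_zero.mp h).resolve_left ?_
  exact (Finset.card_pos.mpr ⟨p, by simp⟩).ne.symm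

/-- With as many indices as index values, an `sl`-invariant tensor is alternating. -/
lemma comp_swap {Q : (ι → ι) → M} (hQ : SlInvariant Q) (i : ι → ι) {p q : ι} (hpq : p ≠ q) :
    Q (i ∘ Equiv.swap p q) = -Q i := by
  have : Nonempty ι := ⟨p⟩
  by_cases hi : Function.Injective i
  · have hne : i q ≠ i p := fun h => hpq (hi h).symm
    have h := hQ.sum_ite_update hne (Function.update i p (i q))
    rw [Fintype.sum_eq_add p q hpq] at h
    · have hs : Function.update (Function.update i p (i q)) q (i p) = i ∘ Equiv.swap p q := by
        ext r
        by_cases hq : r = q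
        · simp [hq]
        · by_cases hp : r = p
          · simp [hp, hpq]
          · simp [hq, hp, Equiv.swap_apply_of_ne_of_ne]
      simp only [Function.update_self, Function.update_of_ne hpq.symm, if_true,
        Function.update_idem, Function.update_eq_self, hs] at h
      exact eq_neg_of_add_eq_zero_right h
    · rintro r ⟨hp, hq⟩
      rw [Function.update_of_ne hp, if_neg fun h => hq (hi h)]
  · obtain ⟨b, hb⟩ : ∃ b, b ∉ Set.range i := by
      by_contra! h
      exact hi (Finite.injective_iff_surjective.mpr h)
    rw [hQ.eq_zero_of_notMem_range hb, neg_zero]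
    exact hQ.eq_zero_of_notMem_range fun ⟨r, hr⟩ => hb ⟨_, hr⟩

/-- There are no nonzero symmetric `sl₂`-invariant tensors of positive order. -/
lemma eq_zero_of_symm [Nonempty ι] {Q : (ι → Fin 2) → M} (hQ : SlInvariant Q)
    (hsymm : ∀ k p q, p ≠ q → Q (k ∘ Equiv.swap p q) = Q k) (k : ι → Fin 2) : Q k = 0 := by
  have := IsAddTorsionFree.of_isTorsionFree ℂ M
  by_cases hk : (1 : Fin 2) ∈ Set.range k
  · obtain ⟨p, hp⟩ := hk
    have h := hQ.sum_ite_update zero_ne_one (Function.update k p 0)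
    have hterm : ∀ q, Function.update k p 0 q = 0 →
        Q (Function.update (Function.update k p 0) q 1) = Q k := by
      intro q hq
      by_cases hpq : p = q
      · subst hpq
        simp [← hp]
      · rw [← hsymm k p q hpq]
        congr 1
        rw [Function.update_of_ne (Ne.symm hpq)] at hq
        ext1 r
        by_cases hrq : r = q
        · simp [hrq, hp]
        · by_cases hrp : r = p
          · simp [hrp, hpq, hq]
          · simp [hrq, hrp, Equiv.swap_apply_of_ne_of_ne]
    rw [← Finset.sum_filter, Finset.sum_congr rfl fun q hq => hterm q (Finset.mem_filter.mp hq).2,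
      Finset.sum_const] at h
    refine (smul_eq_zero.mp h).resolve_left ?_
    exact (Finset.card_pos.mpr ⟨p, by simp⟩).ne.symm
  · exact hQ.eq_zero_of_notMem_range hk

end SlInvariant

end SlInvariant

section IteratedPDeriv

variable {σ R : Type*} [CommRing R]

lemma Derivation.finset_sum_apply {A M ι : Type*} [CommRing A] [Algebra R A] [AddCommGroup M]
    [Module A M] [Module R M] (s : Finset ι) (D : ι → Derivation R A M) (x : A) :
    (∑ i ∈ s, D i) x = ∑ i ∈ s, D i x := by
  rw [← Derivation.coeFnAddMonoidHom_apply, map_sum, Finset.sum_apply]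
  rfl

lemma MvPolynomial.pderiv_comm (u v : σ) (f : MvPolynomial σ R) :
    pderiv u (pderiv v f) = pderiv v (pderiv u f) := by
  classical
  have h : ⁅pderiv (R := R) u, pderiv (R := R) v⁆ = 0 := by
    refine derivation_ext fun w => ?_
    rw [Derivation.commutator_apply, pderiv_X, pderiv_X, Pi.single_apply, Pi.single_apply]
    split_ifs <;> simp
  rw [← sub_eq_zero, ← Derivation.commutator_apply, h, Derivation.zero_apply]

instance : LeftCommutative fun (v : σ) (f : MvPolynomial σ R) => pderiv v f :=
  ⟨pderiv_comm⟩

/-- The iterated partial derivative of `f` in the variables `t p`, for `p : ι`. -/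
noncomputable def iteratedPDeriv {ι : Type*} [Fintype ι] (f : MvPolynomial σ R) (t : ι → σ) :
    MvPolynomial σ R :=
  (Finset.univ.val.map t).foldr (fun v g => pderiv v g) f

lemma iteratedPDeriv_comp_perm {ι : Type*} [Fintype ι] (f : MvPolynomial σ R) (t : ι → σ)
    (e : Equiv.Perm ι) : iteratedPDeriv f (t ∘ e) = iteratedPDeriv f t := by
  rw [iteratedPDeriv, ← Multiset.map_map, Multiset.map_univ_val_equiv, iteratedPDeriv]

lemma iteratedPDeriv_fin_four (f : MvPolynomial σ R) (t : Fin 4 → σ) :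
    iteratedPDeriv f t = pderiv (t 0) (pderiv (t 1) (pderiv (t 2) (pderiv (t 3) f))) :=
  rfl

lemma MvPolynomial.IsHomogeneous.eq_zero_of_pderiv [Fintype σ] [IsDomain R] [CharZero R]
    {f : MvPolynomial σ R} {n : ℕ} (hf : f.IsHomogeneous n) (hn : n ≠ 0)
    (h : ∀ v, pderiv v f = 0) : f = 0 := by
  have := hf.sum_X_mul_pderiv
  simp only [h, mul_zero, Finset.sum_const_zero, nsmul_eq_mul] at this
  exact (mul_eq_zero.mp this.symm).resolve_left (Nat.cast_ne_zero.mpr hn)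

end IteratedPDeriv

lemma pderiv_liederiv (A B : Matrix (Fin 4) (Fin 4) ℂ) (C : Matrix (Fin 2) (Fin 2) ℂ)
    (i j : Fin 4) (k : Fin 2) (f : MvPolynomial (Fin 4 × Fin 4 × Fin 2) ℂ) :
    pderiv (i, j, k) (liederiv A B C f) = liederiv A B C (pderiv (i, j, k) f) +
      ((∑ a, A i a • pderiv (a, j, k) f) + (∑ b, B j b • pderiv (i, b, k) f) +
        ∑ c, C k c • pderiv (i, j, c) f) := by
  have h : ⁅pderiv (R := ℂ) (i, j, k), liederiv A B C⁆ =
      (∑ a, A i a • pderiv (a, j, k)) + (∑ b, B j b • pderiv (i, b, k)) +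
        ∑ c, C k c • pderiv (i, j, c) := by
    refine derivation_ext fun ⟨a, b, c⟩ => ?_
    have hX : ∀ u, liederiv A B C (pderiv u (X (a, b, c))) = 0 := fun u => by
      rw [pderiv_X, Pi.single_apply]
      split_ifs <;> simp
    rw [Derivation.commutator_apply, hX, sub_zero, liederiv, mkDerivation_X]
    simp only [map_add, map_sum, Derivation.map_smul, pderiv_X, Pi.single_apply,
      Derivation.add_apply, Derivation.smul_apply, Derivation.finset_sum_apply, Prod.mk.injEq,
      ite_and, smul_ite, smul_zero, Finset.sum_ite_irrel, Finset.sum_const_zero,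
      Finset.sum_ite_eq, Finset.sum_ite_eq', Finset.mem_univ, if_true]
  rw [← sub_eq_iff_eq_add', ← Derivation.commutator_apply, h]
  simp only [Derivation.add_apply, Derivation.smul_apply, Derivation.finset_sum_apply]

lemma MvPolynomial.IsHomogeneous.liederiv_iteratedPDeriv
    {f : MvPolynomial (Fin 4 × Fin 4 × Fin 2) ℂ} (hf : f.IsHomogeneous 4)
    (A B : Matrix (Fin 4) (Fin 4) ℂ) (C : Matrix (Fin 2) (Fin 2) ℂ)
    (t : Fin 4 → Fin 4 × Fin 4 × Fin 2) : liederiv A B C (iteratedPDeriv f t) = 0 := by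
  have h : (iteratedPDeriv f t).IsHomogeneous 0 := hf.pderiv.pderiv.pderiv.pderiv
  rw [totalDegree_eq_zero_iff_eq_C.mp ((MvPolynomial.totalDegree_zero_iff_isHomogeneous _).mpr h),
    derivation_C]

lemma InvariantPoly.sum_iteratedPDeriv
    {f : MvPolynomial (Fin 4 × Fin 4 × Fin 2) ℂ} (hinv : InvariantPoly f)
    (hf : f.IsHomogeneous 4)
    {A B : Matrix (Fin 4) (Fin 4) ℂ} {C : Matrix (Fin 2) (Fin 2) ℂ}
    (hA : A.trace = 0) (hB : B.trace = 0) (hC : C.trace = 0) (i j : Fin 4 → Fin 4)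
    (k : Fin 4 → Fin 2) :
    ∑ p, ((∑ a, A (i p) a • iteratedPDeriv f fun q => (Function.update i p a q, j q, k q)) +
      (∑ b, B (j p) b • iteratedPDeriv f fun q => (i q, Function.update j p b q, k q)) +
      ∑ c, C (k p) c • iteratedPDeriv f fun q => (i q, j q, Function.update k p c q)) = 0 := by
  have h := hf.liederiv_iteratedPDeriv A B C fun q => (i q, j q, k q)
  have hexp : pderiv (i 0, j 0, k 0) (pderiv (i 1, j 1, k 1) (pderiv (i 2, j 2, k 2)
      (pderiv (i 3, j 3, k 3) (liederiv A B C f)))) = 0 := by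
    simp only [hinv A B C hA hB hC, map_zero]
  simp only [pderiv_liederiv, map_add, map_sum, Derivation.map_smul] at hexp
  simp only [iteratedPDeriv_fin_four] at h
  rw [h, zero_add] at hexp
  rw [Fin.sum_univ_four]
  simpa only [iteratedPDeriv_fin_four, Function.update_apply, Fin.reduceEq, if_true, if_false]
    using hexp

/-- Theorem 16 (degree 4): there is no nonzero invariant homogeneous polynomial of
degree 4 for `4 × 4 × 2` arrays. -/
theorem no_invariant_of_degree_four (f : MvPolynomial (Fin 4 × Fin 4 × Fin 2) ℂ)
    (hhom : f.IsHomogeneous 4) (hinv : InvariantPoly f) :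
    f = 0 := by
  have hi : ∀ (j : Fin 4 → Fin 4) (k : Fin 4 → Fin 2), SlInvariant fun i : Fin 4 → Fin 4 =>
      iteratedPDeriv f fun q => (i q, j q, k q) := fun j k A hA i => by
    simpa using hinv.sum_iteratedPDeriv hhom hA (Matrix.trace_zero _ _) (Matrix.trace_zero _ _)
      i j k
  have hj : ∀ (i : Fin 4 → Fin 4) (k : Fin 4 → Fin 2), SlInvariant fun j : Fin 4 → Fin 4 =>
      iteratedPDeriv f fun q => (i q, j q, k q) := fun i k B hB j => by
    simpa using hinv.sum_iteratedPDeriv hhom (Matrix.trace_zero _ _) hB (Matrix.trace_zero _ _)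
      i j k
  have hk : ∀ i j : Fin 4 → Fin 4, SlInvariant fun k : Fin 4 → Fin 2 =>
      iteratedPDeriv f fun q => (i q, j q, k q) := fun i j C hC k => by
    simpa using hinv.sum_iteratedPDeriv hhom (Matrix.trace_zero _ _) (Matrix.trace_zero _ _) hC
      i j k
  have hzero : ∀ t, iteratedPDeriv f t = 0 := fun t =>
    (hk (fun q => (t q).1) (fun q => (t q).2.1)).eq_zero_of_symm
      (fun k p q hpq => by
        rw [← neg_neg (iteratedPDeriv f fun r => _), ← (hi _ _).comp_swap _ hpq,
          ← (hj _ _).comp_swap _ hpq]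
        exact iteratedPDeriv_comp_perm f (fun r => ((t r).1, (t r).2.1, k r)) (Equiv.swap p q))
      fun q => (t q).2.2
  refine hhom.eq_zero_of_pderiv (by norm_num) fun a =>
    hhom.pderiv.eq_zero_of_pderiv (by norm_num) fun b =>
    hhom.pderiv.pderiv.eq_zero_of_pderiv (by norm_num) fun c =>
    hhom.pderiv.pderiv.pderiv.eq_zero_of_pderiv (by norm_num) fun d => ?_
  exact hzero ![d, c, b, a]
end

section
/- The ℂ-vector space of invariant homogeneous polynomials of degree 8 in the polynomial ring ℂ[x_{ijk}] with variables indexed by (i,j,k) ∈ {1,2,3,4} × {1,2,3,4} × {1,2} has dimension exactly 1. -/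
open MvPolynomial

open Matrix

theorem Derivation.map_prod {R A ι : Type*} [CommRing R] [CommRing A] [Algebra R A] [DecidableEq ι]
    (d : Derivation R A A) (s : Finset ι) (f : ι → A) :
    d (∏ i ∈ s, f i) = ∑ i ∈ s, (∏ j ∈ s.erase i, f j) * d (f i) := by
  induction s using Finset.induction_on with
  | empty => simp
  | insert a s ha ih =>
    rw [Finset.prod_insert ha, d.leibniz, ih, Finset.sum_insert ha, Finset.erase_insert ha,
      smul_eq_mul, smul_eq_mul, add_comm, Finset.mul_sum]
    congr 1
    refine Finset.sum_congr rfl fun i hi => ?_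
    rw [Finset.erase_insert_of_ne (by rintro rfl; exact ha hi),
      Finset.prod_insert (by simp [ha]), mul_assoc]

/-- Jacobi's formula for the derivative of a determinant. -/
theorem Derivation.map_det {R A n : Type*} [CommRing R] [CommRing A] [Algebra R A]
    [Fintype n] [DecidableEq n] (d : Derivation R A A) (M : Matrix n n A) :
    d M.det = (M.adjugate * M.map d).trace := by
  have key (i : n) : (M.adjugate * M.map d) i i =
      ∑ σ : Equiv.Perm n, (Equiv.Perm.sign σ : ℤ) •
        ((∏ j ∈ Finset.univ.erase i, M (σ j) j) * d (M (σ i) i)) := by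
    have h : (M.adjugate * M.map d) i i = M.cramer (fun j => d (M j i)) i := by
      rw [cramer_eq_adjugate_mulVec]; rfl
    rw [h, cramer_apply, det_apply]
    refine Finset.sum_congr rfl fun σ _ => ?_
    rw [← Finset.prod_erase_mul _ _ (Finset.mem_univ i), updateCol_self]
    congr 2
    refine Finset.prod_congr rfl fun j hj => ?_
    rw [updateCol_ne (Finset.ne_of_mem_erase hj)]
  simp_rw [trace, diag_apply, key]
  rw [Finset.sum_comm, det_apply, map_sum]
  refine Finset.sum_congr rfl fun σ _ => ?_
  rw [← Finset.smul_sum, ← d.map_prod]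
  exact map_zsmul d _ _

/-- The coordinate ring of `4 × 4 × 2` arrays. -/
abbrev ArrayPoly : Type := MvPolynomial (Fin 4 × Fin 4 × Fin 2) ℂ

/-- The generic `4 × 4` slices of a `4 × 4 × 2` array. -/
noncomputable def genericSlice (k : Fin 2) :
    Matrix (Fin 4) (Fin 4) ArrayPoly :=
  Matrix.of fun i j => X (i, j, k)

/-- The generic matrix pencil. -/
noncomputable def genericPencil :
    Matrix (Fin 4) (Fin 4) (Polynomial ArrayPoly) :=
  (genericSlice 0).map Polynomial.C +
    (Polynomial.X : Polynomial ArrayPoly) •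
      (genericSlice 1).map Polynomial.C

/-- The coefficients of the determinant of the generic pencil. -/
noncomputable def pencilCoeff (k : ℕ) : ArrayPoly :=
  genericPencil.det.coeff k

theorem pencilCoeff_five : pencilCoeff 5 = 0 := by
  have h := Polynomial.natDegree_det_X_add_C_le (genericSlice 1) (genericSlice 0)
  apply Polynomial.coeff_eq_zero_of_natDegree_lt
  rw [genericPencil, add_comm]
  exact lt_of_le_of_lt h (by simp)

/-- A derivation acting on the coefficients of a polynomial. -/
noncomputable def Derivation.onCoeffs {R A : Type*} [CommRing R] [CommRing A] [Algebra R A]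
    (d : Derivation R A A) : Derivation R (Polynomial A) (Polynomial A) :=
  PolynomialModule.equivPolynomialSelf.compDer d.mapCoeffs

theorem Derivation.coeff_onCoeffs {R A : Type*} [CommRing R] [CommRing A] [Algebra R A]
    (d : Derivation R A A) (p : Polynomial A) (k : ℕ) :
    (d.onCoeffs p).coeff k = d (p.coeff k) := rfl

theorem liederiv_X (A B : Matrix (Fin 4) (Fin 4) ℂ) (C : Matrix (Fin 2) (Fin 2) ℂ)
    (v : Fin 4 × Fin 4 × Fin 2) :
    liederiv A B C (X v) = (∑ i' : Fin 4, A i' v.1 • X (i', v.2.1, v.2.2)) +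
      (∑ j' : Fin 4, B j' v.2.1 • X (v.1, j', v.2.2)) +
      (∑ k' : Fin 2, C k' v.2.2 • X (v.1, v.2.1, k')) :=
  mkDerivation_X ..

theorem map_onCoeffs_genericPencil (A B : Matrix (Fin 4) (Fin 4) ℂ)
    (C : Matrix (Fin 2) (Fin 2) ℂ) :
    genericPencil.map (liederiv A B C).onCoeffs =
      (A.map (algebraMap ℂ (Polynomial ArrayPoly)))ᵀ * genericPencil +
      genericPencil * B.map (algebraMap ℂ (Polynomial ArrayPoly)) +
      (algebraMap ℂ (Polynomial ArrayPoly) (C 0 0) +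
        Polynomial.X * algebraMap ℂ (Polynomial ArrayPoly) (C 0 1)) •
          (genericSlice 0).map Polynomial.C +
      (algebraMap ℂ (Polynomial ArrayPoly) (C 1 0) +
        Polynomial.X * algebraMap ℂ (Polynomial ArrayPoly) (C 1 1)) •
          (genericSlice 1).map Polynomial.C := by
  have hX : (liederiv A B C).onCoeffs Polynomial.X = 0 := by
    ext1 k
    rw [Derivation.coeff_onCoeffs, Polynomial.coeff_X]
    split_ifs <;> simp
  have hC (q : ArrayPoly) : (liederiv A B C).onCoeffs (Polynomial.C q) =
      Polynomial.C (liederiv A B C q) := by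
    ext1 k
    rw [Derivation.coeff_onCoeffs, Polynomial.coeff_C, Polynomial.coeff_C]
    split_ifs <;> simp
  ext1 i j
  simp only [genericPencil, map_apply, Matrix.add_apply, Matrix.smul_apply, mul_apply, transpose_apply,
    genericSlice, of_apply, smul_eq_mul, map_add, Derivation.leibniz, hX, hC, liederiv_X,
    Fin.sum_univ_four, Fin.sum_univ_two, Algebra.smul_def, map_mul,
    Polynomial.algebraMap_eq, IsScalarTower.algebraMap_apply ℂ ArrayPoly (Polynomial ArrayPoly)]
  ring

theorem derivative_det_genericPencil : Polynomial.derivative genericPencil.det =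
    (genericPencil.adjugate * (genericSlice 1).map Polynomial.C).trace := by
  have h := (Polynomial.derivative' (R := ArrayPoly)).map_det genericPencil
  have hM : genericPencil.map (Polynomial.derivative' (R := ArrayPoly)) =
      (genericSlice 1).map Polynomial.C := by
    ext1 i j
    simp [genericPencil]
  rwa [hM] at h

theorem onCoeffs_det_genericPencil (A B : Matrix (Fin 4) (Fin 4) ℂ)
    (C : Matrix (Fin 2) (Fin 2) ℂ) :
    (liederiv A B C).onCoeffs genericPencil.det =
      algebraMap ℂ (Polynomial ArrayPoly) (A.trace + B.trace) * genericPencil.det +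
      (algebraMap ℂ (Polynomial ArrayPoly) (C 0 0) +
        Polynomial.X * algebraMap ℂ (Polynomial ArrayPoly) (C 0 1)) *
          (4 * genericPencil.det - Polynomial.X * Polynomial.derivative genericPencil.det) +
      (algebraMap ℂ (Polynomial ArrayPoly) (C 1 0) +
        Polynomial.X * algebraMap ℂ (Polynomial ArrayPoly) (C 1 1)) *
          Polynomial.derivative genericPencil.det := by
  have htr (N : Matrix (Fin 4) (Fin 4) ℂ) :
      (N.map (algebraMap ℂ (Polynomial ArrayPoly))).trace =
        algebraMap ℂ (Polynomial ArrayPoly) N.trace := by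
    simp [trace, map_sum]
  have hS : (genericSlice 0).map Polynomial.C = genericPencil -
      (Polynomial.X : Polynomial ArrayPoly) • (genericSlice 1).map Polynomial.C := by
    simp [genericPencil]
  rw [Derivation.map_det, map_onCoeffs_genericPencil, hS]
  simp only [mul_add, mul_sub, trace_add, trace_sub, Matrix.mul_smul, smul_sub, trace_smul, smul_eq_mul,
    ← derivative_det_genericPencil]
  rw [trace_mul_comm, mul_assoc, mul_adjugate, ← mul_assoc, adjugate_mul]
  simp only [Matrix.mul_smul, Matrix.smul_mul, mul_one, one_mul, trace_smul, smul_eq_mul,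
    trace_one, trace_transpose, htr, map_add, Fintype.card_fin]
  push_cast
  ring

theorem liederiv_pencilCoeff_succ (A B : Matrix (Fin 4) (Fin 4) ℂ)
    (C : Matrix (Fin 2) (Fin 2) ℂ) (k : ℕ) :
    liederiv A B C (pencilCoeff (k + 1)) =
      (A.trace + B.trace + C 0 0 * (3 - k) + C 1 1 * (k + 1)) • pencilCoeff (k + 1) +
        (C 0 1 * (4 - k)) • pencilCoeff k + (C 1 0 * (k + 2)) • pencilCoeff (k + 2) := by
  have h := congr_arg (fun p => p.coeff (k + 1)) (onCoeffs_det_genericPencil A B C)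
  simp only [Derivation.coeff_onCoeffs] at h
  simp only [pencilCoeff, h]
  simp only [IsScalarTower.algebraMap_apply ℂ ArrayPoly (Polynomial ArrayPoly),
    Polynomial.algebraMap_eq, add_mul, mul_assoc, mul_sub, Polynomial.coeff_add,
    Polynomial.coeff_sub, Polynomial.coeff_C_mul, Polynomial.coeff_X_mul,
    Polynomial.coeff_derivative, Polynomial.coeff_ofNat_mul, Algebra.smul_def,
    map_add, map_mul, map_sub, map_natCast, map_ofNat, map_one]
  cases k with
  | zero => simp; ring
  | succ k => simp [Polynomial.coeff_X_mul, Polynomial.coeff_derivative]; ring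

theorem liederiv_pencilCoeff_zero (A B : Matrix (Fin 4) (Fin 4) ℂ)
    (C : Matrix (Fin 2) (Fin 2) ℂ) :
    liederiv A B C (pencilCoeff 0) =
      (A.trace + B.trace + 4 * C 0 0) • pencilCoeff 0 + C 1 0 • pencilCoeff 1 := by
  have h := congr_arg (fun p => p.coeff 0) (onCoeffs_det_genericPencil A B C)
  simp only [Derivation.coeff_onCoeffs] at h
  simp only [pencilCoeff, h]
  simp only [IsScalarTower.algebraMap_apply ℂ ArrayPoly (Polynomial ArrayPoly),
    Polynomial.algebraMap_eq, add_mul, mul_assoc, mul_sub, Polynomial.coeff_add,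
    Polynomial.coeff_sub, Polynomial.coeff_C_mul, Polynomial.coeff_X_mul_zero,
    Polynomial.coeff_derivative, Polynomial.coeff_ofNat_mul, Algebra.smul_def,
    map_add, map_mul, map_ofNat]
  simp
  ring

/-- The invariant of degree two of the binary quartic `det (x A₀ + y A₁)`. -/
noncomputable def quarticInvariant : ArrayPoly :=
  12 * pencilCoeff 0 * pencilCoeff 4 - 3 * pencilCoeff 1 * pencilCoeff 3 + pencilCoeff 2 ^ 2

theorem liederiv_quarticInvariant (A B : Matrix (Fin 4) (Fin 4) ℂ)
    (C : Matrix (Fin 2) (Fin 2) ℂ) :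
    liederiv A B C quarticInvariant =
      (2 * (A.trace + B.trace + 2 * C.trace)) • quarticInvariant := by
  have h0 := liederiv_pencilCoeff_zero A B C
  have h1 := liederiv_pencilCoeff_succ A B C 0
  have h2 := liederiv_pencilCoeff_succ A B C 1
  have h3 := liederiv_pencilCoeff_succ A B C 2
  have h4 := liederiv_pencilCoeff_succ A B C 3
  have h5 := pencilCoeff_five
  have hn (n : ℕ) [n.AtLeastTwo] : liederiv A B C (OfNat.ofNat n) = 0 :=
    (liederiv A B C).map_natCast n
  norm_num [Algebra.smul_def, h5] at h0 h1 h2 h3 h4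
  simp only [quarticInvariant, map_add, map_sub, Derivation.leibniz, Derivation.leibniz_pow,
    smul_eq_mul, h0, h1, h2, h3, h4, hn, Algebra.smul_def, trace, Fin.sum_univ_two, diag_apply,
    map_mul, map_ofNat, algebraMap_eq]
  norm_num
  ring

/-- A derivation rescaling each variable acts diagonally on coefficients. -/
theorem MvPolynomial.coeff_derivation_of_forall_X {σ R : Type*} [CommRing R]
    (d : Derivation R (MvPolynomial σ R) (MvPolynomial σ R)) (w : σ → R)
    (hd : ∀ v, d (X v) = w v • X v) (f : MvPolynomial σ R) (m : σ →₀ ℕ) :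
    coeff m (d f) = (m.sum fun v n => n * w v) * coeff m f := by
  classical
  have hmon (s : σ →₀ ℕ) (a : R) :
      d (monomial s a) = (s.sum fun v n => n * w v) • monomial s a := by
    have hd' : d = mkDerivation R fun v => w v • X v :=
      derivation_ext fun v => by rw [hd, mkDerivation_X]
    rw [hd', mkDerivation_monomial, Finsupp.sum, Finsupp.sum, Finset.smul_sum, Finset.sum_smul]
    refine Finset.sum_congr rfl fun v hv => ?_
    have hs : s - Finsupp.single v 1 + Finsupp.single v 1 = s :=
      tsub_add_cancel_of_le (Finsupp.single_le_iff.2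
        (Nat.one_le_iff_ne_zero.2 (Finsupp.mem_support_iff.1 hv)))
    rw [X, smul_monomial, smul_eq_mul, monomial_mul, hs, smul_monomial, smul_monomial]
    congr 1
    simp only [smul_eq_mul]
    ring
  induction f using MvPolynomial.induction_on' with
  | monomial s a =>
    rw [hmon, coeff_smul, coeff_monomial]
    split_ifs with h
    · rw [h, smul_eq_mul]
    · simp
  | add p q hp hq => rw [map_add, coeff_add, coeff_add, hp, hq, mul_add]

theorem quarticInvariant_isHomogeneous : quarticInvariant.IsHomogeneous 8 := by
  intro m hm
  have h := coeff_derivation_of_forall_X (liederiv 1 0 0) (fun _ => 1)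
    (fun v => by simp [liederiv_X, one_apply]) quarticInvariant m
  rw [liederiv_quarticInvariant, coeff_smul] at h
  have h8 := mul_right_cancel₀ hm h
  have hdeg : ((m.degree : ℕ) : ℂ) = 8 := by
    rw [Finsupp.degree_apply]
    push_cast
    simpa [Finsupp.sum, trace_one] using h8.symm.trans (by norm_num [trace_one])
  have hdeg' : m.degree = 8 := by exact_mod_cast hdeg
  rwa [Finsupp.degree_eq_weight_one] at hdeg'

theorem invariantPoly_quarticInvariant : InvariantPoly quarticInvariant := by
  intro A B C hA hB hC
  simp [liederiv_quarticInvariant, hA, hB, hC]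

/-- The array with slices `M 0` and `M 1`, as a point at which polynomials can be evaluated. -/
def arrayOfSlices (M : Fin 2 → Matrix (Fin 4) (Fin 4) ℂ) : Fin 4 × Fin 4 × Fin 2 → ℂ :=
  fun v => M v.2.2 v.1 v.2.1

theorem eval_pencilCoeff (M : Fin 2 → Matrix (Fin 4) (Fin 4) ℂ) (k : ℕ) :
    eval (arrayOfSlices M) (pencilCoeff k) =
      ((M 0).map Polynomial.C + (Polynomial.X : Polynomial ℂ) • (M 1).map Polynomial.C).det.coeff
        k := by
  rw [pencilCoeff, ← Polynomial.coeff_map, ← Polynomial.coe_mapRingHom, RingHom.map_det]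
  congr 2
  ext1 i j
  simp [genericPencil, genericSlice, arrayOfSlices]

theorem quarticInvariant_ne_zero : quarticInvariant ≠ 0 := by
  intro h
  let M : Fin 2 → Matrix (Fin 4) (Fin 4) ℂ := ![diagonal ![1, 1, 0, 0], diagonal ![0, 0, 1, 1]]
  have hdet : ((M 0).map Polynomial.C +
      (Polynomial.X : Polynomial ℂ) • (M 1).map Polynomial.C).det = Polynomial.X ^ 2 := by
    have hM : (M 0).map Polynomial.C + (Polynomial.X : Polynomial ℂ) • (M 1).map Polynomial.C =
        diagonal ![1, 1, Polynomial.X, Polynomial.X] := by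
      ext1 i j
      fin_cases i <;> fin_cases j <;> simp [M]
    rw [hM, det_diagonal, Fin.prod_univ_four]
    simp [pow_two]
  have h1 := congr_arg (eval (arrayOfSlices M)) h
  simp [quarticInvariant, eval_pencilCoeff, hdet, Polynomial.coeff_X_pow] at h1

theorem MvPolynomial.eval_add_smul_eq_of_derivation_eq_zero {σ : Type*}
    (d : Derivation ℂ (MvPolynomial σ ℂ) (MvPolynomial σ ℂ)) (x y : σ → ℂ)
    (h : ∀ (t : ℂ) (v : σ), eval (x + t • y) (d (X v)) = y v) {f : MvPolynomial σ ℂ}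
    (hf : d f = 0) (t : ℂ) : eval (x + t • y) f = eval x f := by
  have hderiv (g : MvPolynomial σ ℂ) (t : ℂ) :
      HasDerivAt (fun s : ℂ => eval (x + s • y) g) (eval (x + t • y) (d g)) t := by
    induction g using MvPolynomial.induction_on with
    | C a =>
      have ha : d (C a) = 0 := d.map_algebraMap a
      simpa [ha] using hasDerivAt_const t a
    | add p q hp hq => simpa using! hp.add hq
    | mul_X p v hp =>
      have hv : HasDerivAt (fun s : ℂ => eval (x + s • y) (X v)) (y v) t := by
        simpa using ((hasDerivAt_id t).mul_const (y v)).const_add (x v)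
      simp only [map_mul, Derivation.leibniz, map_add, smul_eq_mul, h]
      exact (hp.mul hv).congr_deriv (by ring)
  have hd : Differentiable ℂ fun s : ℂ => eval (x + s • y) f :=
    fun t => (hderiv f t).differentiableAt
  have := is_const_of_deriv_eq_zero hd (fun s => by rw [(hderiv f s).deriv, hf, map_zero]) t 0
  simpa using this

theorem eval_liederiv_X (A B : Matrix (Fin 4) (Fin 4) ℂ) (C : Matrix (Fin 2) (Fin 2) ℂ)
    (M : Fin 2 → Matrix (Fin 4) (Fin 4) ℂ) (v : Fin 4 × Fin 4 × Fin 2) :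
    eval (arrayOfSlices M) (liederiv A B C (X v)) =
      arrayOfSlices (fun k => Aᵀ * M k + M k * B + ∑ k', C k' k • M k') v := by
  simp [liederiv_X, arrayOfSlices, mul_apply, smul_eval, mul_comm]

theorem InvariantPoly.eval_add_smul {f : ArrayPoly} (hf : InvariantPoly f)
    {A B : Matrix (Fin 4) (Fin 4) ℂ} {C : Matrix (Fin 2) (Fin 2) ℂ}
    (hA : A.trace = 0) (hB : B.trace = 0) (hC : C.trace = 0)
    (M N : Fin 2 → Matrix (Fin 4) (Fin 4) ℂ)
    (h : ∀ (t : ℂ) k, Aᵀ * (M k + t • N k) + (M k + t • N k) * B +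
      ∑ k', C k' k • (M k' + t • N k') = N k) (t : ℂ) :
    eval (arrayOfSlices fun k => M k + t • N k) f = eval (arrayOfSlices M) f := by
  refine eval_add_smul_eq_of_derivation_eq_zero (liederiv A B C) (arrayOfSlices M)
    (arrayOfSlices N) (fun s v => ?_) (hf A B C hA hB hC) t
  have := eval_liederiv_X A B C (fun k => M k + s • N k) v
  simp only [h] at this
  exact this

/-- If a multidegree is orthogonal to all trace-zero weights pulled back along `π`, it is
equidistributed over the fibres of `π`. -/
theorem Finsupp.card_mul_sum_of_forall_sum_eq_zero {σ ι : Type*} [Fintype ι] [Nonempty ι]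
    (m : σ →₀ ℕ) (π : σ → ι)
    (h : ∀ a : ι → ℂ, ∑ i, a i = 0 → (m.sum fun v n => n * a (π v)) = 0) (φ : ι → ℂ) :
    Fintype.card ι * (m.sum fun v n => n * φ (π v)) = m.degree * ∑ i, φ i := by
  have hcard : (Fintype.card ι : ℂ) ≠ 0 := by simp
  have h' := h (fun i => Fintype.card ι * φ i - ∑ j, φ j) (by
    simp [Finset.sum_sub_distrib, Finset.mul_sum])
  simp only [Finsupp.sum, mul_sub, Finset.sum_sub_distrib, sub_eq_zero] at h'
  rw [Finsupp.degree_apply, Finsupp.sum, Finset.mul_sum, Nat.cast_sum, Finset.sum_mul, ← h']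
  exact Finset.sum_congr rfl fun v _ => by ring

theorem Finsupp.sum_fiber_eq {σ ι : Type*} [Fintype σ] [Fintype ι] [DecidableEq ι] [Nonempty ι]
    {m : σ →₀ ℕ} {π : σ → ι} {d : ℕ} (hm : m.degree = Fintype.card ι * d)
    (h : ∀ a : ι → ℂ, ∑ i, a i = 0 → (m.sum fun v n => n * a (π v)) = 0) (i : ι) :
    ∑ v with π v = i, m v = d := by
  have h' := m.card_mul_sum_of_forall_sum_eq_zero π h (Pi.single i 1)
  rw [hm, Finset.sum_pi_single' i (1 : ℂ), if_pos (Finset.mem_univ i), mul_one, Nat.cast_mul,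
    Finsupp.sum_fintype _ _ (by simp)] at h'
  have h'' := mul_left_cancel₀ (by simp) h'
  rw [Finset.sum_filter]
  simp only [Pi.single_apply, mul_ite, mul_one, mul_zero] at h''
  exact_mod_cast h''

theorem MvPolynomial.eval_mul_comp {σ ι : Type*} [Fintype σ] [Fintype ι] [DecidableEq ι]
    {R : Type*} [CommRing R] {f : MvPolynomial σ R} {π : σ → ι} {d : ℕ}
    (h : ∀ m, coeff m f ≠ 0 → ∀ i, ∑ v with π v = i, m v = d) (t : ι → R) (x : σ → R) :
    eval (fun v => t (π v) * x v) f = (∏ i, t i) ^ d * eval x f := by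
  rw [eval_eq', eval_eq', Finset.mul_sum]
  refine Finset.sum_congr rfl fun m hm => ?_
  have ht : ∏ v, t (π v) ^ m v = (∏ i, t i) ^ d := by
    rw [← Finset.prod_fiberwise Finset.univ π, ← Finset.prod_pow]
    refine Finset.prod_congr rfl fun i _ => ?_
    rw [← h m (mem_support_iff.1 hm) i, ← Finset.prod_pow_eq_pow_sum]
    exact Finset.prod_congr rfl fun v hv => by rw [(Finset.mem_filter.1 hv).2]
  simp only [mul_pow, Finset.prod_mul_distrib, ht]
  ring

theorem InvariantPoly.weight_eq_zero {f : ArrayPoly} (hf : InvariantPoly f)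
    {m : Fin 4 × Fin 4 × Fin 2 →₀ ℕ} (hm : coeff m f ≠ 0) {a b : Fin 4 → ℂ} {c : Fin 2 → ℂ}
    (ha : ∑ i, a i = 0) (hb : ∑ j, b j = 0) (hc : ∑ k, c k = 0) :
    (m.sum fun v n => n * (a v.1 + b v.2.1 + c v.2.2)) = 0 := by
  have h := coeff_derivation_of_forall_X (liederiv (diagonal a) (diagonal b) (diagonal c))
    (fun v => a v.1 + b v.2.1 + c v.2.2)
    (fun v => by simp [liederiv_X, diagonal_apply, add_smul]) f m
  rw [hf _ _ _ (by simpa using ha) (by simpa using hb) (by simpa using hc), coeff_zero] at h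
  exact (mul_eq_zero.1 h.symm).resolve_right hm

theorem InvariantPoly.sum_fiber_eq {f : ArrayPoly} (hf : InvariantPoly f)
    (hd : f.IsHomogeneous 8) {m : Fin 4 × Fin 4 × Fin 2 →₀ ℕ} (hm : coeff m f ≠ 0) :
    (∀ i, ∑ v with v.1 = i, m v = 2) ∧ (∀ j, ∑ v with v.2.1 = j, m v = 2) ∧
      (∀ k, ∑ v with v.2.2 = k, m v = 4) := by
  have hdeg : m.degree = 8 := by
    rw [Finsupp.degree_eq_weight_one]
    exact hd hm
  refine ⟨Finsupp.sum_fiber_eq (by simp [hdeg]) fun a ha => ?_,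
    Finsupp.sum_fiber_eq (by simp [hdeg]) fun a ha => ?_,
    Finsupp.sum_fiber_eq (by simp [hdeg]) fun a ha => ?_⟩
  · simpa using hf.weight_eq_zero hm (b := 0) (c := 0) ha (by simp) (by simp)
  · simpa using hf.weight_eq_zero hm (a := 0) (c := 0) (by simp) ha (by simp)
  · simpa using hf.weight_eq_zero hm (a := 0) (b := 0) (by simp) (by simp) ha

theorem InvariantPoly.eval_mul_left {f : ArrayPoly} (hf : InvariantPoly f)
    (hd : f.IsHomogeneous 8) (g : Matrix (Fin 4) (Fin 4) ℂ)
    (M : Fin 2 → Matrix (Fin 4) (Fin 4) ℂ) :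
    eval (arrayOfSlices fun k => g * M k) f = g.det ^ 2 * eval (arrayOfSlices M) f := by
  induction g using diagonal_transvection_induction generalizing M with
  | hdiag t _ =>
    rw [det_diagonal, ← eval_mul_comp (fun m hm => (hf.sum_fiber_eq hd hm).1)]
    congr 2
    ext v
    simp [arrayOfSlices]
  | htransvec t =>
    obtain ⟨i, j, hij, c⟩ := t
    have := hf.eval_add_smul (A := single j i 1) (B := 0) (C := 0) (by simp [hij.symm])
      (by simp) (by simp) M (fun k => single i j 1 * M k) (fun s k => by
        simp [mul_add, ← mul_assoc, hij.symm]) c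
    rw [TransvectionStruct.det, one_pow, one_mul, ← this]
    simp [TransvectionStruct.toMatrix, transvection, add_mul, ← Matrix.smul_mul, smul_single]
  | hmul A B hA hB =>
    simp only [mul_assoc]
    rw [hA, hB, det_mul]
    ring

theorem InvariantPoly.eval_mul_right {f : ArrayPoly} (hf : InvariantPoly f)
    (hd : f.IsHomogeneous 8) (g : Matrix (Fin 4) (Fin 4) ℂ)
    (M : Fin 2 → Matrix (Fin 4) (Fin 4) ℂ) :
    eval (arrayOfSlices fun k => M k * g) f = g.det ^ 2 * eval (arrayOfSlices M) f := by
  induction g using diagonal_transvection_induction generalizing M with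
  | hdiag t _ =>
    rw [det_diagonal, ← eval_mul_comp (fun m hm => (hf.sum_fiber_eq hd hm).2.1)]
    congr 2
    ext v
    simp [arrayOfSlices, mul_comm]
  | htransvec t =>
    obtain ⟨i, j, hij, c⟩ := t
    have := hf.eval_add_smul (A := 0) (B := single i j 1) (C := 0) (by simp)
      (by simp [hij]) (by simp) M (fun k => M k * single i j 1) (fun s k => by
        simp [add_mul, mul_assoc, hij.symm]) c
    rw [TransvectionStruct.det, one_pow, one_mul, ← this]
    simp [TransvectionStruct.toMatrix, transvection, mul_add, ← Matrix.mul_smul, smul_single]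
  | hmul A B hA hB =>
    simp only [← mul_assoc]
    rw [hB, hA, det_mul]
    ring

/-- Over an algebraically closed field every endomorphism is triangularizable. -/
theorem Module.End.exists_basis_repr_eq_zero_of_lt {K : Type*} [Field K] [IsAlgClosed K] {n : ℕ}
    {V : Type*} [AddCommGroup V] [Module K V] [FiniteDimensional K V]
    (hn : Module.finrank K V = n) (T : Module.End K V) :
    ∃ b : Module.Basis (Fin n) K V, ∀ i j, i < j → b.repr (T (b j)) i = 0 := by
  induction n generalizing V with
  | zero => exact ⟨Module.finBasisOfFinrankEq K V hn, fun i => i.elim0⟩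
  | succ n ih =>
    have : Nontrivial V := Module.nontrivial_of_finrank_pos (R := K) (by omega)
    obtain ⟨μ, hμ⟩ := Module.End.exists_eigenvalue (K := K) (V := Module.Dual K V) T.dualMap
    obtain ⟨φ, hφ⟩ := hμ.exists_hasEigenvector
    have hφT (x : V) : φ (T x) = μ * φ x := by
      simpa using LinearMap.congr_fun hφ.apply_eq_smul x
    have hker := Module.Dual.finrank_ker_add_one_of_ne_zero hφ.2
    obtain ⟨b, hb⟩ := ih (V := LinearMap.ker φ) (by omega)
      (T.restrict fun x hx => by
        rw [LinearMap.mem_ker] at hx ⊢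
        rw [hφT, hx, mul_zero])
    obtain ⟨y, hy⟩ : ∃ y, φ y ≠ 0 := by
      by_contra! h
      exact hφ.2 (LinearMap.ext h)
    let b' : Module.Basis (Fin (n + 1)) K V := Module.Basis.mkFinCons y b
      (fun c x hx hcx => by
        have := congr_arg φ hcx
        rw [LinearMap.mem_ker] at hx
        simpa [hx, hy] using this)
      (fun z => ⟨-(φ z / φ y), by simp [LinearMap.mem_ker, hy]⟩)
    have hsucc (i : Fin n) : b' i.succ = b i := by simp [b', Module.Basis.coe_mkFinCons]
    have hrepr (w : LinearMap.ker φ) :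
        b'.repr (w : V) = ∑ i, Finsupp.single i.succ (b.repr w i) := by
      have hw : (w : V) = ∑ i, b.repr w i • b' i.succ := by
        simp_rw [hsucc]
        conv_lhs => rw [← b.sum_repr w]
        simp only [Submodule.coe_sum, Submodule.coe_smul]
      conv_lhs => rw [hw, map_sum]
      simp only [map_smul, Module.Basis.repr_self, Finsupp.smul_single, smul_eq_mul, mul_one]
    refine ⟨b', fun i j hij => ?_⟩
    obtain ⟨j, rfl⟩ := Fin.exists_succ_eq.2 (Fin.ne_zero_of_lt hij)
    have hT := hrepr (T.restrict (fun x hx => by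
        rw [LinearMap.mem_ker] at hx ⊢
        rw [hφT, hx, mul_zero]) (b j))
    rw [LinearMap.coe_restrict_apply, ← hsucc] at hT
    rw [hT, Finsupp.finsetSum_apply]
    refine Finset.sum_eq_zero fun k _ => ?_
    rw [Finsupp.single_apply]
    split_ifs with hk
    · exact hb k j (by rwa [← hk, Fin.succ_lt_succ_iff] at hij)
    · rfl

theorem Matrix.exists_mul_eq_mul_lowerTriangular {K : Type*} [Field K] [IsAlgClosed K] {n : ℕ}
    (M : Matrix (Fin n) (Fin n) K) :
    ∃ P T : Matrix (Fin n) (Fin n) K, IsUnit P ∧ M * P = P * T ∧ ∀ i j, i < j → T i j = 0 := by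
  obtain ⟨b, hb⟩ := Module.End.exists_basis_repr_eq_zero_of_lt (Module.finrank_fin_fun K) M.toLin'
  refine ⟨of fun i j => b j i, of fun i j => b.repr (M.toLin' (b j)) i, ?_, ?_, hb⟩
  · exact linearIndependent_cols_iff_isUnit.1 b.linearIndependent
  · ext i j
    have := congr_fun (b.sum_repr (M.toLin' (b j))) i
    rw [Finset.sum_apply] at this
    simp only [mul_apply, of_apply]
    simp only [Pi.smul_apply, smul_eq_mul, toLin'_apply, mulVec, dotProduct] at this
    rw [← this]
    exact Finset.sum_congr rfl fun k _ => mul_comm _ _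

theorem InvariantPoly.eval_one_lowerTriangular {f : ArrayPoly} (hf : InvariantPoly f)
    (hd : f.IsHomogeneous 8) {T : Matrix (Fin 4) (Fin 4) ℂ} (hT : ∀ i j, i < j → T i j = 0) :
    eval (arrayOfSlices ![1, T]) f = eval (arrayOfSlices ![1, diagonal T.diag]) f := by
  rw [eval_eq', eval_eq']
  refine Finset.sum_congr rfl fun m hm => congr_arg _ ?_
  obtain ⟨hrow, hcol, -⟩ := hf.sum_fiber_eq hd (mem_support_iff.1 hm)
  have hsum (π : Fin 4 × Fin 4 × Fin 2 → Fin 4) (hπ : ∀ i, ∑ v with π v = i, m v = 2) :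
      ∑ v, m v * (π v : ℕ) = 12 := by
    rw [← Finset.sum_fiberwise Finset.univ π]
    have (i : Fin 4) : ∑ v with π v = i, m v * (π v : ℕ) = 2 * i := by
      trans (∑ v with π v = i, m v) * i
      · rw [Finset.sum_mul]
        exact Finset.sum_congr rfl fun v hv => by rw [(Finset.mem_filter.1 hv).2]
      · rw [hπ]
    simp [this, Fin.sum_univ_four]
  by_cases hlow : ∀ v, m v ≠ 0 → v.2.1 ≤ v.1
  · have heq := (Finset.sum_eq_sum_iff_of_le fun v _ => ?_).1
      ((hsum (fun v => v.2.1) hcol).trans (hsum (fun v => v.1) hrow).symm)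
    · refine Finset.prod_congr rfl fun v hv => ?_
      rcases eq_or_ne (m v) 0 with h0 | h0
      · simp [h0]
      · have hv' : v.2.1 = v.1 := Fin.ext (Nat.eq_of_mul_eq_mul_left (Nat.pos_of_ne_zero h0)
          (heq v hv))
        obtain ⟨i, j, k⟩ := v
        obtain rfl : j = i := hv'
        fin_cases k <;> simp [arrayOfSlices]
    · rcases eq_or_ne (m v) 0 with h0 | h0
      · simp [h0]
      · exact Nat.mul_le_mul_left _ (hlow v h0)
  · push Not at hlow
    obtain ⟨⟨i, j, k⟩, h0, hij⟩ := hlow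
    have hij' : i < j := hij
    rw [Finset.prod_eq_zero (Finset.mem_univ (i, j, k)),
      Finset.prod_eq_zero (Finset.mem_univ (i, j, k))]
    · rw [pow_eq_zero_iff h0]
      fin_cases k <;> simp [arrayOfSlices, hij'.ne]
    · rw [pow_eq_zero_iff h0]
      fin_cases k <;> simp [arrayOfSlices, hij'.ne, hT i j hij']

theorem InvariantPoly.eq_zero_of_eval_diagonal {f : ArrayPoly} (hf : InvariantPoly f)
    (hd : f.IsHomogeneous 8)
    (h : ∀ b : Fin 4 → ℂ, eval (arrayOfSlices ![1, diagonal b]) f = 0) : f = 0 := by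
  have hinv (M : Fin 2 → Matrix (Fin 4) (Fin 4) ℂ) (hM : IsUnit (M 0).det) :
      eval (arrayOfSlices M) f = 0 := by
    obtain ⟨P, T, hP, hPT, hT⟩ := exists_mul_eq_mul_lowerTriangular ((M 0)⁻¹ * M 1)
    rw [isUnit_iff_isUnit_det] at hP
    have hslices : M = fun k => (M 0 * P) * (![1, T] k * P⁻¹) := by
      ext1 k
      fin_cases k
      · simp [mul_assoc, mul_nonsing_inv _ hP]
      · calc M 1 = M 0 * ((M 0)⁻¹ * M 1 * P) * P⁻¹ := by
              simp [mul_assoc, mul_nonsing_inv _ hP, mul_nonsing_inv_cancel_left _ _ hM]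
          _ = _ := by simp [hPT, mul_assoc]
    rw [hslices, hf.eval_mul_left hd, hf.eval_mul_right hd, hf.eval_one_lowerTriangular hd hT, h]
    simp
  have hdet (x : Fin 4 × Fin 4 × Fin 2 → ℂ) :
      eval x (genericSlice 0).det = (of fun i j => x (i, j, 0)).det := by
    rw [RingHom.map_det]
    congr 1
    ext1 i j
    simp [genericSlice]
  have hmul : f * (genericSlice 0).det = 0 := by
    refine MvPolynomial.funext fun x => ?_
    rw [map_mul, hdet, map_zero, mul_eq_zero]
    by_contra! hx
    exact hx.1 (hinv (fun k => of fun i j => x (i, j, k)) hx.2.isUnit)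
  refine (mul_eq_zero.1 hmul).resolve_right fun h0 => ?_
  have := hdet (arrayOfSlices fun _ => 1)
  rw [h0, map_zero] at this
  exact zero_ne_one (this.trans (det_one (n := Fin 4)))

/-- The restriction of a polynomial to the arrays with slices `1` and `diagonal b`. -/
noncomputable def diagonalRestriction : ArrayPoly →ₐ[ℂ] MvPolynomial (Fin 4) ℂ :=
  aeval fun v => if v.1 = v.2.1 then ![1, X v.1] v.2.2 else 0

theorem eval_diagonalRestriction (b : Fin 4 → ℂ) (f : ArrayPoly) :
    eval b (diagonalRestriction f) = eval (arrayOfSlices ![1, diagonal b]) f := by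
  induction f using MvPolynomial.induction_on with
  | C a => simp [diagonalRestriction]
  | add p q hp hq => simp [hp, hq]
  | mul_X p v hp =>
    obtain ⟨i, j, k⟩ := v
    rw [map_mul, map_mul, map_mul, hp, eval_X]
    congr 1
    fin_cases k <;> by_cases h : i = j <;>
      simp [diagonalRestriction, arrayOfSlices, h]

theorem sum_pderiv_diagonalRestriction (f : ArrayPoly) :
    ∑ i, pderiv i (diagonalRestriction f) =
      diagonalRestriction (liederiv 0 0 (single 0 1 1) f) := by
  induction f using MvPolynomial.induction_on with
  | C a => simp [diagonalRestriction]
  | add p q hp hq => simp [← hp, ← hq, Finset.sum_add_distrib]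
  | mul_X p v hp =>
    obtain ⟨i, j, k⟩ := v
    have hX : ∑ a, pderiv a (diagonalRestriction (X (i, j, k))) =
        diagonalRestriction (liederiv 0 0 (single 0 1 1) (X (i, j, k))) := by
      rw [liederiv_X]
      fin_cases k <;> by_cases h : i = j <;>
        simp [diagonalRestriction, h, Pi.single_apply, single_apply]
    simp only [map_mul, Derivation.leibniz, map_add, smul_eq_mul, Finset.sum_add_distrib,
      ← Finset.mul_sum, hp, hX]

theorem InvariantPoly.sum_pderiv_diagonalRestriction {f : ArrayPoly} (hf : InvariantPoly f) :
    ∑ i, pderiv i (diagonalRestriction f) = 0 := by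
  rw [_root_.sum_pderiv_diagonalRestriction,
    hf 0 0 _ (trace_zero _ _) (trace_zero _ _) (trace_single_eq_of_ne _ _ _ (by decide)), map_zero]

theorem InvariantPoly.rename_diagonalRestriction {f : ArrayPoly} (hf : InvariantPoly f)
    (hd : f.IsHomogeneous 8) (σ : Equiv.Perm (Fin 4)) :
    rename σ (diagonalRestriction f) = diagonalRestriction f := by
  refine MvPolynomial.funext fun b => ?_
  rw [eval_rename, eval_diagonalRestriction, eval_diagonalRestriction]
  have hslices : (![1, diagonal (b ∘ σ)] : Fin 2 → Matrix (Fin 4) (Fin 4) ℂ) =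
      fun k => (σ.permMatrix ℂ) * (![1, diagonal b] k * (σ⁻¹).permMatrix ℂ) := by
    ext1 k
    fin_cases k
    · simp [← Matrix.permMatrix_mul]
    · ext i j
      have hσ : (σ⁻¹).symm j = σ j := rfl
      simp [PEquiv.toMatrix_toPEquiv_mul, PEquiv.mul_toMatrix_toPEquiv, diagonal_apply, hσ]
  rw [hslices, hf.eval_mul_left hd, hf.eval_mul_right hd, ← mul_assoc, ← mul_pow, ← det_mul,
    ← Matrix.permMatrix_mul]
  simp

theorem InvariantPoly.le_two_of_coeff_diagonalRestriction_ne_zero {f : ArrayPoly}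
    (hf : InvariantPoly f) (hd : f.IsHomogeneous 8) {e : Fin 4 →₀ ℕ}
    (he : coeff e (diagonalRestriction f) ≠ 0) : (∀ i, e i ≤ 2) ∧ ∑ i, e i = 4 := by
  rw [diagonalRestriction, aeval_def, eval₂_eq', coeff_sum] at he
  obtain ⟨m, hm, hme⟩ := Finset.exists_ne_zero_of_sum_ne_zero he
  obtain ⟨hrow, -, hslice⟩ := hf.sum_fiber_eq hd (mem_support_iff.1 hm)
  rw [algebraMap_eq, coeff_C_mul] at hme
  replace hme := right_ne_zero_of_mul hme
  let w (v : Fin 4 × Fin 4 × Fin 2) : Fin 4 →₀ ℕ := if v.2.2 = 1 then Finsupp.single v.1 1 else 0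
  have hprod : (∏ v, (if v.1 = v.2.1 then ![1, X v.1] v.2.2 else 0 : MvPolynomial (Fin 4) ℂ) ^ m v) =
      monomial (∑ v, m v • w v) 1 := by
    rw [monomial_sum_one]
    refine Finset.prod_congr rfl fun v _ => ?_
    obtain ⟨i, j, k⟩ := v
    rcases eq_or_ne (m (i, j, k)) 0 with h0 | h0
    · simp [h0]
    have hij : i = j := by
      by_contra hij
      refine hme ?_
      rw [Finset.prod_eq_zero (Finset.mem_univ (i, j, k)), coeff_zero]
      simp [hij, h0]
    subst hij
    fin_cases k
    · simp [w]
    · simp [w, X_pow_eq_monomial]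
  rw [hprod, coeff_monomial, ne_eq, ite_eq_right_iff, Classical.not_imp] at hme
  rw [← hme.1]
  constructor
  · intro i
    refine le_trans ?_ (hrow i).le
    rw [Finsupp.finsetSum_apply, Finset.sum_filter]
    refine Finset.sum_le_sum fun v _ => ?_
    by_cases h1 : v.2.2 = 1 <;> by_cases h2 : v.1 = i <;> simp [w, h1, h2]
  · refine Eq.trans ?_ (hslice 1)
    rw [Finset.sum_filter]
    simp only [Finsupp.finsetSum_apply]
    rw [Finset.sum_comm]
    refine Finset.sum_congr rfl fun v _ => ?_
    by_cases h1 : v.2.2 = 1 <;> simp [w, h1, Finsupp.single_apply]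

theorem MvPolynomial.eq_zero_of_sum_pderiv_eq_zero {g : MvPolynomial (Fin 4) ℂ}
    (hsupp : ∀ e, coeff e g ≠ 0 → (∀ i, e i ≤ 2) ∧ ∑ i, e i = 4)
    (hsymm : ∀ σ : Equiv.Perm (Fin 4), rename σ g = g) (hderiv : ∑ i, pderiv i g = 0)
    (h : coeff (Finsupp.equivFunOnFinite.symm ![0, 0, 2, 2]) g = 0) : g = 0 := by
  set c : (Fin 4 → ℕ) → ℂ := fun e => coeff (Finsupp.equivFunOnFinite.symm e) g with hc
  have hperm (e : Fin 4 → ℕ) (σ : Equiv.Perm (Fin 4)) : c (e ∘ σ) = c e := by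
    have h1 := coeff_rename_mapDomain σ σ.injective g (Finsupp.equivFunOnFinite.symm (e ∘ σ))
    rw [hsymm] at h1
    rw [hc]
    simp only
    rw [← h1]
    congr 1
    ext i
    obtain ⟨i, rfl⟩ := σ.surjective i
    rw [Finsupp.mapDomain_apply σ.injective]
    rfl
  have hsum (e : Fin 4 → ℕ) : ∑ i, c (e + Pi.single i 1) * (e i + 1) = 0 := by
    have h1 := congr_arg (coeff (Finsupp.equivFunOnFinite.symm e)) hderiv
    rw [coeff_sum, coeff_zero] at h1
    rw [← h1]
    refine Finset.sum_congr rfl fun i _ => ?_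
    rw [coeff_pderiv]
    congr 2
    simp only [hc]
    congr 1
    ext j
    simp [Finsupp.single_apply, Pi.single_apply, eq_comm]
  have h1 : c ![0, 1, 1, 2] = 0 := by
    have := hsum ![0, 0, 1, 2]
    have h3 : c ![0, 0, 1, 3] = 0 := by
      by_contra h3
      simpa using (hsupp _ h3).1 3
    have hswap : c ![1, 0, 1, 2] = c ![0, 1, 1, 2] := by
      rw [← hperm _ (Equiv.swap 0 1)]
      congr 1
      decide
    rw [Fin.sum_univ_four, show ![0, 0, 1, 2] + Pi.single 0 1 = ![1, 0, 1, 2] by decide,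
      show ![0, 0, 1, 2] + Pi.single 1 1 = ![0, 1, 1, 2] by decide,
      show ![0, 0, 1, 2] + Pi.single 2 1 = ![0, 0, 2, 2] by decide,
      show ![0, 0, 1, 2] + Pi.single 3 1 = ![0, 0, 1, 3] by decide, hswap, h3,
      show c ![0, 0, 2, 2] = 0 from h] at this
    simpa using this
  have h2 : c ![1, 1, 1, 1] = 0 := by
    have := hsum ![0, 1, 1, 1]
    have ha : c ![0, 2, 1, 1] = c ![0, 1, 1, 2] := by
      rw [← hperm _ (Equiv.swap 1 3)]
      congr 1
      decide
    have hb : c ![0, 1, 2, 1] = c ![0, 1, 1, 2] := by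
      rw [← hperm _ (Equiv.swap 2 3)]
      congr 1
      decide
    rw [Fin.sum_univ_four, show ![0, 1, 1, 1] + Pi.single 0 1 = ![1, 1, 1, 1] by decide,
      show ![0, 1, 1, 1] + Pi.single 1 1 = ![0, 2, 1, 1] by decide,
      show ![0, 1, 1, 1] + Pi.single 2 1 = ![0, 1, 2, 1] by decide,
      show ![0, 1, 1, 1] + Pi.single 3 1 = ![0, 1, 1, 2] by decide, ha, hb, h1] at this
    simpa using this
  have hall (e : Fin 4 → ℕ) : c e = 0 := by
    by_contra he
    rw [← hperm e (Tuple.sort e)] at he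
    have hmono := Tuple.monotone_sort e
    obtain ⟨hle, hsum4⟩ := hsupp _ he
    generalize e ∘ Tuple.sort e = e' at *
    have e01 : e' 0 ≤ e' 1 := hmono (by decide)
    have e12 : e' 1 ≤ e' 2 := hmono (by decide)
    have e23 : e' 2 ≤ e' 3 := hmono (by decide)
    have e3 : e' 3 ≤ 2 := hle 3
    replace hsum4 : e' 0 + e' 1 + e' 2 + e' 3 = 4 := by simpa [Fin.sum_univ_four] using hsum4
    have he' : e' = ![e' 0, e' 1, e' 2, e' 3] := by
      ext i
      fin_cases i <;> rfl
    obtain ⟨h0', h1', h2', h3'⟩ | ⟨h0', h1', h2', h3'⟩ | ⟨h0', h1', h2', h3'⟩ :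
        (e' 0 = 0 ∧ e' 1 = 0 ∧ e' 2 = 2 ∧ e' 3 = 2) ∨ (e' 0 = 0 ∧ e' 1 = 1 ∧ e' 2 = 1 ∧ e' 3 = 2) ∨
          (e' 0 = 1 ∧ e' 1 = 1 ∧ e' 2 = 1 ∧ e' 3 = 1) := by omega
    all_goals rw [h0', h1', h2', h3'] at he'
    exacts [he (he' ▸ h), he (he' ▸ h1), he (he' ▸ h2)]
  ext e
  simpa [hc] using hall e

theorem InvariantPoly.eq_zero_of_coeff_eq_zero {f : ArrayPoly} (hf : InvariantPoly f)
    (hd : f.IsHomogeneous 8)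
    (h : coeff (Finsupp.equivFunOnFinite.symm ![0, 0, 2, 2]) (diagonalRestriction f) = 0) :
    f = 0 := by
  refine hf.eq_zero_of_eval_diagonal hd fun b => ?_
  rw [← eval_diagonalRestriction, eq_zero_of_sum_pderiv_eq_zero
    (fun e => hf.le_two_of_coeff_diagonalRestriction_ne_zero hd)
    (hf.rename_diagonalRestriction hd) hf.sum_pderiv_diagonalRestriction h, map_zero]

/-- Theorem 16 (degree 8): the space of invariant homogeneous polynomials of degree 8 for
`4 × 4 × 2` arrays is one-dimensional. -/
theorem invariants_degree_eight_dim_one :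
    ∃ f₀ : MvPolynomial (Fin 4 × Fin 4 × Fin 2) ℂ, f₀ ≠ 0 ∧ f₀.IsHomogeneous 8 ∧
      InvariantPoly f₀ ∧
      ∀ f : MvPolynomial (Fin 4 × Fin 4 × Fin 2) ℂ, f.IsHomogeneous 8 → InvariantPoly f →
        ∃ c : ℂ, f = c • f₀ := by
  refine ⟨quarticInvariant, quarticInvariant_ne_zero, quarticInvariant_isHomogeneous,
    invariantPoly_quarticInvariant, fun f hd hf => ?_⟩
  let ℓ : ArrayPoly →ₗ[ℂ] ℂ :=
    lcoeff ℂ (Finsupp.equivFunOnFinite.symm ![0, 0, 2, 2]) ∘ₗ diagonalRestriction.toLinearMap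
  have hℓ : ℓ quarticInvariant ≠ 0 := fun h0 => quarticInvariant_ne_zero
    (invariantPoly_quarticInvariant.eq_zero_of_coeff_eq_zero quarticInvariant_isHomogeneous h0)
  refine ⟨ℓ f / ℓ quarticInvariant, sub_eq_zero.1 (InvariantPoly.eq_zero_of_coeff_eq_zero ?_ ?_ ?_)⟩
  · intro A B C hA hB hC
    rw [map_sub, Derivation.map_smul, hf A B C hA hB hC,
      invariantPoly_quarticInvariant A B C hA hB hC, smul_zero, sub_zero]
  · exact (homogeneousSubmodule _ ℂ 8).sub_mem hd
      ((homogeneousSubmodule _ ℂ 8).smul_mem _ quarticInvariant_isHomogeneous)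
  · change ℓ (f - _) = 0
    rw [map_sub, map_smul, smul_eq_mul, div_mul_cancel₀ _ hℓ, sub_self]
end
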